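/- Let Λ be a commutative Artinian local ring with residue field k, and M a finitely generated Λ-module whose first syzygy Ω M (kernel of a minimal projective cover P₀ → M) satisfies: Ext¹_Λ(k, Ω M) = 0. If moreover Ext¹_Λ(M, Λ) = 0, then M is projective. -/

import Mathlib

open CategoryTheory

universe u

noncomputable abbrev ExtGrp (Λ : Type u) [Ring Λ] (M N : ModuleCat.{u} Λ) (n : ℕ) :
    Type u :=
  ((Ext ℤ (ModuleCat.{u} Λ) n).obj (Opposite.op M)).obj N

/-- If `Ext¹(X, Y) = 0`, then every `1`-cocycle `P₁ ⟶ Y` on a projective resolution `P` of `X` is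
a coboundary. -/
theorem CategoryTheory.ProjectiveResolution.exists_d_comp_eq_of_subsingleton_ext
    {Λ : Type u} [Ring Λ] {X : ModuleCat.{u} Λ} (P : ProjectiveResolution X) (Y : ModuleCat.{u} Λ)
    (h : Subsingleton (((Ext ℤ (ModuleCat.{u} Λ) 1).obj (Opposite.op X)).obj Y))
    (f : P.complex.X 1 ⟶ Y) (hf : P.complex.d 2 1 ≫ f = 0) :
    ∃ e : P.complex.X 0 ⟶ Y, P.complex.d 1 0 ≫ e = f := by
  have hz : Limits.IsZero ((P.complex.linearYonedaObj ℤ Y).homology 1) :=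
    (ModuleCat.isZero_of_subsingleton _).of_iso (P.isoExt 1 Y).symm
  rw [← HomologicalComplex.exactAt_iff_isZero_homology,
    HomologicalComplex.exactAt_iff' _ 0 1 2 (by simp) (by simp),
    ShortComplex.moduleCat_exact_iff] at hz
  exact hz f hf

/-- Vanishing of `Ext¹(Λ ⧸ I, N)` allows linear maps to `N` to be extended from `I` to `Λ`. -/
theorem exists_extend_of_subsingleton_ext_quotient {Λ : Type u} [CommRing Λ] (I : Ideal Λ)
    (N : Type u) [AddCommGroup N] [Module Λ N]
    (h : Subsingleton (((Ext ℤ (ModuleCat.{u} Λ) 1).obj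
      (Opposite.op (ModuleCat.of Λ (Λ ⧸ I)))).obj (ModuleCat.of Λ N)))
    (φ : I →ₗ[Λ] N) : ∃ ψ : Λ →ₗ[Λ] N, ∀ x : I, ψ x = φ x := by
  let P := projectiveResolution (ModuleCat.of Λ (Λ ⧸ I))
  let π : P.complex.X 0 ⟶ ModuleCat.of Λ (Λ ⧸ I) := P.π.f 0
  have hdπ : P.complex.d 1 0 ≫ π = 0 := P.complex_d_comp_π_f_zero
  have hexact : (ShortComplex.mk (P.complex.d 1 0) π hdπ).Exact := P.exact₀
  have : Epi π := inferInstanceAs (Epi (P.π.f 0))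
  have hπ : Function.Surjective π.hom := (ModuleCat.epi_iff_surjective π).mp this
  have : Module.Projective Λ (P.complex.X 0) :=
    (IsProjective.iff_projective _).mpr (P.projective 0)
  obtain ⟨l, hl⟩ := Module.projective_lifting_property I.mkQ π.hom I.mkQ_surjective
  have hl' (x) : Submodule.Quotient.mk (l x) = π.hom x := LinearMap.congr_fun hl x
  have hd (z) : π.hom ((P.complex.d 1 0).hom z) = 0 :=
    LinearMap.congr_fun (congrArg ModuleCat.Hom.hom hdπ) z
  let ld : P.complex.X 1 →ₗ[Λ] I := (l ∘ₗ (P.complex.d 1 0).hom).codRestrict I fun z ↦ by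
    rw [← Submodule.Quotient.mk_eq_zero I, LinearMap.comp_apply, hl', hd]
  obtain ⟨e, he⟩ := P.exists_d_comp_eq_of_subsingleton_ext _ h (ModuleCat.ofHom (φ ∘ₗ ld)) <| by
    ext z
    have hz : (P.complex.d 1 0).hom ((P.complex.d 2 1).hom z) = 0 :=
      LinearMap.congr_fun (congrArg ModuleCat.Hom.hom (P.complex.d_comp_d 2 1 0)) z
    have : ld ((P.complex.d 2 1).hom z) = 0 := Subtype.ext (by simp [ld, hz])
    change φ (ld ((P.complex.d 2 1).hom z)) = 0
    rw [this, map_zero]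
  have he' (z) : e.hom ((P.complex.d 1 0).hom z) = φ (ld z) :=
    LinearMap.congr_fun (congrArg ModuleCat.Hom.hom he) z
  obtain ⟨p, hp⟩ := hπ (I.mkQ 1)
  let s : Λ →ₗ[Λ] P.complex.X 0 := LinearMap.toSpanSingleton Λ _ p
  have hs (x : Λ) : π.hom (s x) = I.mkQ x := by
    simp only [s, LinearMap.toSpanSingleton_apply, map_smul, hp]
    rw [← map_smul, smul_eq_mul, mul_one]
  let r : Λ →ₗ[Λ] I := (LinearMap.id - l ∘ₗ s).codRestrict I fun x ↦ by
    rw [← Submodule.Quotient.mk_eq_zero I, LinearMap.sub_apply, Submodule.Quotient.mk_sub,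
      LinearMap.comp_apply, hl', hs]
    exact sub_self _
  refine ⟨e.hom ∘ₗ s + φ ∘ₗ r, fun x ↦ ?_⟩
  obtain ⟨z, hz⟩ := (ShortComplex.moduleCat_exact_iff _).mp hexact (s x)
    ((hs x).trans ((Submodule.Quotient.mk_eq_zero I).mpr x.2))
  change (P.complex.d 1 0).hom z = s x at hz
  rw [LinearMap.add_apply, LinearMap.comp_apply, LinearMap.comp_apply, ← hz, he', ← map_add]
  congr 1
  ext
  simp [ld, r, hz]

/-- For a proper ideal of an Artinian local ring there is an element outside it which the maximal
ideal multiplies into it. -/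
theorem IsLocalRing.exists_notMem_forall_mul_mem {Λ : Type*} [CommRing Λ] [IsArtinianRing Λ]
    [IsLocalRing Λ] {J : Ideal Λ} (hJ : J ≠ ⊤) :
    ∃ x ∉ J, ∀ a ∈ maximalIdeal Λ, a * x ∈ J := by
  classical
  have hnil : ∃ n, maximalIdeal Λ ^ n ≤ J := by
    obtain ⟨n, hn⟩ := IsArtinianRing.isNilpotent_jacobson_bot (R := Λ)
    rw [IsLocalRing.jacobson_eq_maximalIdeal ⊥ bot_ne_top] at hn
    exact ⟨n, hn.le.trans bot_le⟩
  have hspec := Nat.find_spec hnil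
  rcases hn : Nat.find hnil with _ | n
  · rw [hn, pow_zero, Ideal.one_eq_top, top_le_iff] at hspec
    exact absurd hspec hJ
  · rw [hn, pow_succ'] at hspec
    obtain ⟨x, hx, hxJ⟩ := Set.not_subset.mp (Nat.find_min hnil (m := n) (by omega))
    exact ⟨x, hxJ, fun a ha ↦ hspec (Ideal.mul_mem_mul ha hx)⟩

/-- Over an Artinian local ring, Baer's criterion need only be checked on the maximal ideal. -/
theorem Module.Baer.of_maximalIdeal {Λ : Type*} [CommRing Λ] [IsArtinianRing Λ]
    [IsLocalRing Λ] {N : Type*} [AddCommGroup N] [Module Λ N]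
    (h : ∀ φ : IsLocalRing.maximalIdeal Λ →ₗ[Λ] N, ∃ ψ : Λ →ₗ[Λ] N, ∀ x, ψ x.1 = φ x) :
    Module.Baer Λ N := by
  intro I g
  let S : Set (Ideal Λ) := {J | ∃ f : Λ →ₗ.[Λ] N, f.domain = J ∧ LinearPMap.mk I g ≤ f}
  obtain ⟨J, ⟨f, rfl, hgf⟩, hmax⟩ :=
    set_has_maximal_iff_noetherian.mpr (inferInstanceAs (IsNoetherian Λ Λ)) S ⟨I, _, rfl, le_rfl⟩
  have htop : f.domain = ⊤ := by
    by_contra hne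
    obtain ⟨x, hx, hmx⟩ := IsLocalRing.exists_notMem_forall_mul_mem hne
    have hmem (a : Λ) (ha : a * x ∈ f.domain) : a ∈ IsLocalRing.maximalIdeal Λ := by
      refine (IsLocalRing.mem_maximalIdeal a).mpr fun hu ↦ hx ?_
      obtain ⟨u, rfl⟩ := hu
      simpa using f.domain.smul_mem (↑u⁻¹ : Λ) ha
    obtain ⟨ψ, hψ⟩ := h (f.toFun ∘ₗ
      (LinearMap.toSpanSingleton Λ Λ x ∘ₗ Submodule.subtype _).codRestrict f.domain
        fun a ↦ hmx a a.2)
    have hψ' (a : Λ) (ha : a * x ∈ f.domain) : a • ψ 1 = f ⟨a * x, ha⟩ := by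
      rw [← map_smul, smul_eq_mul, mul_one]
      exact hψ ⟨a, hmem a ha⟩
    have hzero (c : Λ) (hc : c • x = 0) : c • ψ 1 = 0 := by
      have hc' : c * x = 0 := hc
      rw [hψ' c (hc' ▸ f.domain.zero_mem), ← f.map_zero]
      exact congrArg f (Subtype.ext hc')
    let k := LinearPMap.mkSpanSingleton' (σ := RingHom.id Λ) x (ψ 1) hzero
    have hcompat (y : f.domain) (z : k.domain) (hyz : (y : Λ) = z) : f y = k z := by
      obtain ⟨y, hy⟩ := y
      obtain ⟨z, hz⟩ := z
      obtain rfl : y = z := hyz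
      obtain ⟨c, rfl⟩ := Submodule.mem_span_singleton.mp hz
      exact (hψ' c hy).symm.trans (LinearPMap.mkSpanSingleton'_apply (σ := RingHom.id Λ) x (ψ 1) hzero c hz).symm
    refine hmax _ ⟨f.sup k hcompat, rfl, hgf.trans (f.left_le_sup k hcompat)⟩ ?_
    refine lt_of_le_of_ne (f.left_le_sup k hcompat).1 fun heq ↦ hx ?_
    rw [heq]
    exact (f.right_le_sup k hcompat).1 (Submodule.mem_span_singleton_self x)
  refine ⟨f.toFun ∘ₗ LinearMap.id.codRestrict f.domain fun _ ↦ htop ▸ Submodule.mem_top,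
    fun x hx ↦ ?_⟩
  exact (hgf.2 (x := ⟨x, hx⟩) rfl).symm

/-- A finitely generated submodule which is a direct summand and lies in `𝔪 F` vanishes. -/
theorem Submodule.eq_bot_of_le_maximalIdeal_smul_of_retraction {Λ F : Type*} [CommRing Λ]
    [IsLocalRing Λ] [AddCommGroup F] [Module Λ F] {K : Submodule Λ F} (hfg : K.FG)
    (hK : K ≤ IsLocalRing.maximalIdeal Λ • (⊤ : Submodule Λ F))
    (p : F →ₗ[Λ] K) (hp : ∀ x : K, p x = x) : K = ⊥ := by
  refine eq_bot_of_le_smul_of_le_jacobson_bot (IsLocalRing.maximalIdeal Λ) K hfg (fun x hx ↦ ?_)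
    (IsLocalRing.maximalIdeal_le_jacobson ⊥)
  have hle := map_mono (f := K.subtype ∘ₗ p) hK
  rw [map_smul''] at hle
  have hrange : map (K.subtype ∘ₗ p) ⊤ ≤ K := by
    rintro _ ⟨y, -, rfl⟩
    exact (p y).2
  exact smul_mono_right _ hrange (hle ⟨x, hx, congrArg Subtype.val (hp ⟨x, hx⟩)⟩)

theorem stmt17 (Λ : Type u) [CommRing Λ] [IsArtinianRing Λ] [IsLocalRing Λ]
    (M : Type u) [AddCommGroup M] [Module Λ M] [Module.Finite Λ M]
    (q : ℕ) (g : (Fin q → Λ) →ₗ[Λ] M) (hg : Function.Surjective g)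
    (hmin : LinearMap.ker g ≤
      (IsLocalRing.maximalIdeal Λ) • (⊤ : Submodule Λ (Fin q → Λ)))
    (hsyz : Subsingleton (ExtGrp Λ (ModuleCat.of Λ (IsLocalRing.ResidueField Λ))
      (ModuleCat.of Λ (LinearMap.ker g)) 1))
    (hMΛ : Subsingleton (ExtGrp Λ (ModuleCat.of Λ M) (ModuleCat.of Λ Λ) 1)) :
    Module.Projective Λ M := by
  have hbaer : Module.Baer Λ (LinearMap.ker g) :=
    .of_maximalIdeal fun φ ↦ exists_extend_of_subsingleton_ext_quotient _ _ hsyz φ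
  obtain ⟨p, hp⟩ := hbaer.extension_property (LinearMap.ker g).subtype
    (LinearMap.ker g).injective_subtype LinearMap.id
  have hker : LinearMap.ker g = ⊥ :=
    Submodule.eq_bot_of_le_maximalIdeal_smul_of_retraction (IsNoetherian.noetherian _) hmin p
      (LinearMap.congr_fun hp)
  exact Module.Projective.of_equiv (LinearEquiv.ofBijective g ⟨LinearMap.ker_eq_bot.mp hker, hg⟩)
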